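/- arXiv:2510.01489 — 5 statements merged into one kernel-verified Lean document; each statement's English description precedes it below -/
import Mathlib

section
/- Let l > 0 and let r ∈ ℝ² satisfy ‖r‖ < l. Then B(r)ᵀ B(r) = I₂ + r rᵀ / z(r)², this 2×2 matrix is positive definite, its determinant equals l²/z(r)², and in particular B(r)ᵀ B(r) is invertible. -/
open Matrix

/-- z(r) = √(l² − ‖r‖²). -/
noncomputable def zc (l : ℝ) (r : EuclideanSpace ℝ (Fin 2)) : ℝ :=
  Real.sqrt (l ^ 2 - ‖r‖ ^ 2)

/-- The cable vector ℓ(r) = (r₁, r₂, z(r)) ∈ ℝ³. -/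
noncomputable def cableVec (l : ℝ) (r : EuclideanSpace ℝ (Fin 2)) : Fin 3 → ℝ :=
  ![r 0, r 1, zc l r]

/-- The 3×2 matrix B(r): top block the 2×2 identity, bottom row −rᵀ/z(r). -/
noncomputable def Bmat (l : ℝ) (r : EuclideanSpace ℝ (Fin 2)) : Matrix (Fin 3) (Fin 2) ℝ :=
  Matrix.of ![![1, 0], ![0, 1], ![-(r 0) / zc l r, -(r 1) / zc l r]]


theorem zc_pos {l : ℝ} {r : EuclideanSpace ℝ (Fin 2)} (hr : ‖r‖ < l) : 0 < zc l r :=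
  Real.sqrt_pos.mpr (by nlinarith [norm_nonneg r])

theorem zc_sq {l : ℝ} {r : EuclideanSpace ℝ (Fin 2)} (hr : ‖r‖ < l) :
    zc l r ^ 2 = l ^ 2 - (r 0 ^ 2 + r 1 ^ 2) := by
  rw [zc, Real.sq_sqrt (by nlinarith [norm_nonneg r]), EuclideanSpace.real_norm_sq_eq,
    Fin.sum_univ_two]

theorem Bmat_transpose_mul_self (l : ℝ) (r : EuclideanSpace ℝ (Fin 2)) :
    (Bmat l r)ᵀ * Bmat l r =
      1 + (zc l r ^ 2)⁻¹ • Matrix.vecMulVec (fun i => r i) (fun i => r i) := by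
  ext i j
  fin_cases i <;> fin_cases j <;>
    simp [Bmat, Matrix.mul_apply, Fin.sum_univ_three, Matrix.vecMulVec_apply] <;> ring

theorem Bmat_transpose_mul_self_posDef (l : ℝ) (r : EuclideanSpace ℝ (Fin 2)) :
    ((Bmat l r)ᵀ * Bmat l r).PosDef := by
  rw [Bmat_transpose_mul_self]
  refine Matrix.PosDef.one.add_posSemidef (Matrix.PosSemidef.smul ?_ (by positivity))
  simpa using Matrix.posSemidef_vecMulVec_self_star (fun i => r i)

theorem det_Bmat_transpose_mul_self {l : ℝ} {r : EuclideanSpace ℝ (Fin 2)} (hr : ‖r‖ < l) :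
    ((Bmat l r)ᵀ * Bmat l r).det = l ^ 2 / zc l r ^ 2 := by
  have hz := (zc_pos hr).ne'
  have hl : l ^ 2 = zc l r ^ 2 + (r 0 ^ 2 + r 1 ^ 2) := by rw [zc_sq hr]; ring
  rw [Bmat_transpose_mul_self, Matrix.det_fin_two, hl]
  simp [Matrix.vecMulVec_apply]
  field_simp
  ring

/-- B(r)ᵀB(r) = I₂ + r rᵀ/z(r)², is positive definite, has determinant l²/z(r)²,
and is invertible. -/
theorem stmt2 (l : ℝ) (hl : 0 < l) (r : EuclideanSpace ℝ (Fin 2)) (hr : ‖r‖ < l) :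
    (Bmat l r)ᵀ * Bmat l r =
        1 + (zc l r ^ 2)⁻¹ • Matrix.vecMulVec (fun i => r i) (fun i => r i) ∧
      ((Bmat l r)ᵀ * Bmat l r).PosDef ∧
      ((Bmat l r)ᵀ * Bmat l r).det = l ^ 2 / zc l r ^ 2 ∧
      IsUnit ((Bmat l r)ᵀ * Bmat l r) := by
  exact ⟨Bmat_transpose_mul_self l r, Bmat_transpose_mul_self_posDef l r,
    det_Bmat_transpose_mul_self hr, (Bmat_transpose_mul_self_posDef l r).isUnit⟩
end

section
/- Let l > 0 and let r ∈ ℝ² satisfy ‖r‖ < l. Then the column space (range) of the matrix B(r) equals the orthogonal complement of the cable vector ℓ(r) in ℝ³, i.e., {x ∈ ℝ³ : xᵀ ℓ(r) = 0}. -/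
open Matrix

/-- The column space of B(r) equals the orthogonal complement of the cable vector ℓ(r)
in ℝ³. -/
theorem stmt3 (l : ℝ) (hl : 0 < l) (r : EuclideanSpace ℝ (Fin 2)) (hr : ‖r‖ < l) :
    Set.range (Bmat l r).mulVec = {x : Fin 3 → ℝ | x ⬝ᵥ cableVec l r = 0} := by
  have hz : zc l r ≠ 0 := (zc_pos hr).ne'
  ext x
  simp only [Set.mem_range, Set.mem_ofPred_eq]
  constructor
  · rintro ⟨v, rfl⟩
    simp [Bmat, cableVec, Matrix.mulVec, dotProduct, Fin.sum_univ_succ]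
    field_simp
    ring
  · intro h
    refine ⟨![x 0, x 1], ?_⟩
    simp [cableVec, dotProduct, Fin.sum_univ_three] at h
    ext i
    fin_cases i
    · simp [Bmat, Matrix.mulVec, dotProduct]
    · simp [Bmat, Matrix.mulVec, dotProduct]
    · simp [Bmat, Matrix.mulVec, dotProduct]
      field_simp
      linarith
end

section
/- Let l > 0 and let r ∈ ℝ² satisfy ‖r‖ < l, and define 𝔅(r) = B(r)(B(r)ᵀB(r))⁻¹B(r)ᵀ. Then 𝔅(r) = I₃ − ℓ(r)ℓ(r)ᵀ/l²; consequently 𝔅(r) is symmetric, idempotent (𝔅(r)² = 𝔅(r)), and satisfies 𝔅(r) ℓ(r) = 0. -/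
open Matrix

/-- The auxiliary matrix 𝔅(r) = B(r)(B(r)ᵀB(r))⁻¹B(r)ᵀ. -/
noncomputable def frakB (l : ℝ) (r : EuclideanSpace ℝ (Fin 2)) : Matrix (Fin 3) (Fin 3) ℝ :=
  Bmat l r * ((Bmat l r)ᵀ * Bmat l r)⁻¹ * (Bmat l r)ᵀ

theorem sq_eq_zc_sq_add {l : ℝ} {r : EuclideanSpace ℝ (Fin 2)} (hr : ‖r‖ < l) :
    l ^ 2 = zc l r ^ 2 + r 0 ^ 2 + r 1 ^ 2 := by
  have h : 0 ≤ l ^ 2 - ‖r‖ ^ 2 :=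
    sub_nonneg.mpr (pow_le_pow_left₀ (norm_nonneg r) hr.le 2)
  rw [zc, Real.sq_sqrt h, EuclideanSpace.real_norm_sq_eq, Fin.sum_univ_two]
  ring

theorem cableVec_dotProduct_self {l : ℝ} {r : EuclideanSpace ℝ (Fin 2)} (hr : ‖r‖ < l) :
    cableVec l r ⬝ᵥ cableVec l r = l ^ 2 := by
  simp only [cableVec, dotProduct, Fin.sum_univ_three, Matrix.cons_val]
  linear_combination -sq_eq_zc_sq_add hr

theorem Bmat_gram_inv {l : ℝ} (hl : 0 < l) {r : EuclideanSpace ℝ (Fin 2)} (hr : ‖r‖ < l) :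
    ((Bmat l r)ᵀ * Bmat l r)⁻¹ = 1 - (l ^ 2)⁻¹ • vecMulVec (⇑r) (⇑r) := by
  have hz := (zc_pos hr).ne'
  have hl' := hl.ne'
  have hl2 := sq_eq_zc_sq_add hr
  refine Matrix.inv_eq_right_inv ?_
  ext i j
  fin_cases i <;> fin_cases j <;>
    simp [Bmat, Matrix.mul_apply, Fin.sum_univ_two, Fin.sum_univ_three, vecMulVec_apply] <;>
    field_simp <;> rw [hl2] <;> ring

theorem frakB_eq {l : ℝ} (hl : 0 < l) {r : EuclideanSpace ℝ (Fin 2)} (hr : ‖r‖ < l) :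
    frakB l r = 1 - (l ^ 2)⁻¹ • vecMulVec (cableVec l r) (cableVec l r) := by
  have hz := (zc_pos hr).ne'
  have hl' := hl.ne'
  have hl2 := sq_eq_zc_sq_add hr
  rw [frakB, Bmat_gram_inv hl hr]
  ext i j
  fin_cases i <;> fin_cases j <;>
    simp [Bmat, cableVec, -cons_mul, Matrix.mul_apply, Fin.sum_univ_two, vecMulVec_apply] <;>
    field_simp <;> (try rw [hl2]) <;> ring

/-- 𝔅(r) = I₃ − ℓ(r)ℓ(r)ᵀ/l²; hence 𝔅(r) is symmetric, idempotent, and 𝔅(r)ℓ(r) = 0. -/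
theorem stmt4 (l : ℝ) (hl : 0 < l) (r : EuclideanSpace ℝ (Fin 2)) (hr : ‖r‖ < l) :
    frakB l r = 1 - (l ^ 2)⁻¹ • Matrix.vecMulVec (cableVec l r) (cableVec l r) ∧
      (frakB l r)ᵀ = frakB l r ∧
      frakB l r * frakB l r = frakB l r ∧
      (frakB l r).mulVec (cableVec l r) = 0 := by
  have hker : (frakB l r).mulVec (cableVec l r) = 0 := by
    rw [frakB_eq hl hr, sub_mulVec, one_mulVec, smul_mulVec, vecMulVec_mulVec,
      cableVec_dotProduct_self hr, op_smul_eq_smul, inv_smul_smul₀ (pow_ne_zero 2 hl.ne'), sub_self]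
  refine ⟨frakB_eq hl hr, ?_, ?_, hker⟩
  · rw [frakB_eq hl hr, transpose_sub, transpose_one, transpose_smul, transpose_vecMulVec]
  · nth_rewrite 2 [frakB_eq hl hr]
    rw [mul_sub, mul_one, Matrix.mul_smul, mul_vecMulVec, hker, zero_vecMulVec, smul_zero, sub_zero]
end

section
/- Let l > 0 and let r ∈ ℝ² satisfy ‖r‖ < l, and define 𝔅(r) = B(r)(B(r)ᵀB(r))⁻¹B(r)ᵀ. For every δ ∈ ℝ³, writing δ_∥ = (ℓ(r)ℓ(r)ᵀ/l²)δ and δ_⊥ = δ − δ_∥, one has 𝔅(r) δ = 𝔅(r) δ_⊥ = δ_⊥. -/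
open Matrix

theorem Bmat_transpose_mulVec_cableVec {l : ℝ} {r : EuclideanSpace ℝ (Fin 2)} (hr : ‖r‖ < l) :
    (Bmat l r)ᵀ *ᵥ cableVec l r = 0 := by
  have hz := (zc_pos hr).ne'
  ext i
  fin_cases i <;>
    simp [Bmat, cableVec, mulVec, dotProduct, Fin.sum_univ_three, hz]

theorem isUnit_det_Bmat_gram (l : ℝ) (r : EuclideanSpace ℝ (Fin 2)) :
    IsUnit ((Bmat l r)ᵀ * Bmat l r).det := by
  have h : ((Bmat l r)ᵀ * Bmat l r).det = 1 + (r 0 / zc l r) ^ 2 + (r 1 / zc l r) ^ 2 := by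
    simp [det_fin_two, Bmat, mul_apply, Fin.sum_univ_three]
    ring
  rw [h]
  exact (by positivity : 1 + (r 0 / zc l r) ^ 2 + (r 1 / zc l r) ^ 2 ≠ 0).isUnit

theorem frakB_mulVec_cableVec {l : ℝ} {r : EuclideanSpace ℝ (Fin 2)} (hr : ‖r‖ < l) :
    frakB l r *ᵥ cableVec l r = 0 := by
  rw [frakB, ← mulVec_mulVec, Bmat_transpose_mulVec_cableVec hr, mulVec_zero]

theorem frakB_mul_Bmat (l : ℝ) (r : EuclideanSpace ℝ (Fin 2)) :
    frakB l r * Bmat l r = Bmat l r := by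
  rw [frakB, Matrix.mul_assoc, Matrix.mul_assoc, nonsing_inv_mul _ (isUnit_det_Bmat_gram l r),
    Matrix.mul_one]

theorem Bmat_mulVec_of_orthogonal {l : ℝ} {r : EuclideanSpace ℝ (Fin 2)} (hr : ‖r‖ < l)
    {v : Fin 3 → ℝ} (hv : cableVec l r ⬝ᵥ v = 0) : Bmat l r *ᵥ ![v 0, v 1] = v := by
  have hz := (zc_pos hr).ne'
  simp only [cableVec, dotProduct, Fin.sum_univ_three, cons_val] at hv
  ext i
  fin_cases i
  · simp [Bmat, mulVec, dotProduct]
  · simp [Bmat, mulVec, dotProduct]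
  · simp [Bmat, mulVec, dotProduct]
    field_simp
    linarith

theorem frakB_mulVec_of_orthogonal {l : ℝ} {r : EuclideanSpace ℝ (Fin 2)} (hr : ‖r‖ < l)
    {v : Fin 3 → ℝ} (hv : cableVec l r ⬝ᵥ v = 0) : frakB l r *ᵥ v = v := by
  rw [← Bmat_mulVec_of_orthogonal hr hv, mulVec_mulVec, frakB_mul_Bmat]

/-- For every δ ∈ ℝ³, with δ_∥ = (ℓ(r)ℓ(r)ᵀ/l²)δ and δ_⊥ = δ − δ_∥, one has
𝔅(r) δ = 𝔅(r) δ_⊥ = δ_⊥. -/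
theorem stmt7 (l : ℝ) (hl : 0 < l) (r : EuclideanSpace ℝ (Fin 2)) (hr : ‖r‖ < l)
    (δ : Fin 3 → ℝ) :
    (frakB l r).mulVec δ =
        (frakB l r).mulVec
          (δ - ((l ^ 2)⁻¹ • Matrix.vecMulVec (cableVec l r) (cableVec l r)).mulVec δ) ∧
      (frakB l r).mulVec
          (δ - ((l ^ 2)⁻¹ • Matrix.vecMulVec (cableVec l r) (cableVec l r)).mulVec δ) =
        δ - ((l ^ 2)⁻¹ • Matrix.vecMulVec (cableVec l r) (cableVec l r)).mulVec δ := by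
  have hpar : ((l ^ 2)⁻¹ • Matrix.vecMulVec (cableVec l r) (cableVec l r)).mulVec δ =
      ((l ^ 2)⁻¹ * (cableVec l r ⬝ᵥ δ)) • cableVec l r := by
    rw [smul_mulVec, vecMulVec_mulVec, op_smul_eq_smul, smul_smul]
  rw [hpar]
  constructor
  · rw [mulVec_sub, mulVec_smul, frakB_mulVec_cableVec hr, smul_zero, sub_zero]
  · apply frakB_mulVec_of_orthogonal hr
    rw [dotProduct_sub, dotProduct_smul, cableVec_dotProduct_self hr, smul_eq_mul]
    field_simp
    ring
end

section
/- Let N ≥ 1 be a natural number, let c_T, λ_T > 0 and c_j, κ_j > 0 for j = 1, …, N, and let l > 0. Let ℓ_j : ℝ → ℝ³ be functions with ‖ℓ_j(t)‖ = l for all t, and let 𝔅_j(t) = I₃ − ℓ_j(t)ℓ_j(t)ᵀ/l² be the orthogonal projection onto the plane perpendicular to ℓ_j(t). Suppose δ̃_T : ℝ → ℝ³ and δ̃_j : ℝ → ℝ³ are differentiable and satisfy the estimation-error dynamics δ̃_T′(t) = −λ_T (δ̃_T(t) + Σ_{j=1}^{N} δ̃_⊥,j(t)) and δ̃_j′(t)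 = −κ_j 𝔅_j(t) δ̃_⊥,j(t), where δ̃_⊥,j(t) = δ̃_j(t) − (ℓ_j(t)ᵀ δ̃_j(t)/l²) ℓ_j(t). Then the Lyapunov function V_e(t) = (1/2) c_T ‖δ̃_T(t)‖² + (1/2) Σ_{j=1}^{N} (c_T λ_T N/(2κ_j) + c_j/N) ‖δ̃_j(t)‖² is differentiable with derivative V_e′(t) = −c_T λ_T ‖δ̃_T(t)‖² − c_T λ_T Σ_{j=1}^{N} δ̃_⊥,j(t)ᵀ δ̃_T(t) − Σ_{j=1}^{N} (c_T λ_T N/2 + c_j κ_j/N) ‖δ̃_⊥,j(t)‖². -/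
open scoped RealInnerProductSpace

/-- The component of `v` perpendicular to `u` (with ‖u‖ = l):
v_⊥ = v − (uᵀv/l²) u.  Applying it twice to a vector realizes 𝔅 v_⊥
where 𝔅 = I₃ − uuᵀ/l². -/
noncomputable def perpC (l : ℝ) (u v : EuclideanSpace ℝ (Fin 3)) :
    EuclideanSpace ℝ (Fin 3) :=
  v - (⟪u, v⟫ / l ^ 2) • u

theorem inner_perpC_self {l : ℝ} (hl : l ≠ 0) {u : EuclideanSpace ℝ (Fin 3)} (hu : ‖u‖ = l)
    (v : EuclideanSpace ℝ (Fin 3)) : ⟪u, perpC l u v⟫ = 0 := by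
  rw [perpC, inner_sub_right, real_inner_smul_right, real_inner_self_eq_norm_sq, hu,
    div_mul_cancel₀ _ (pow_ne_zero 2 hl), sub_self]

theorem perpC_perpC {l : ℝ} (hl : l ≠ 0) {u : EuclideanSpace ℝ (Fin 3)} (hu : ‖u‖ = l)
    (v : EuclideanSpace ℝ (Fin 3)) : perpC l u (perpC l u v) = perpC l u v := by
  rw [perpC, inner_perpC_self hl hu, zero_div, zero_smul, sub_zero]

theorem inner_perpC_right {l : ℝ} (hl : l ≠ 0) {u : EuclideanSpace ℝ (Fin 3)} (hu : ‖u‖ = l)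
    (v : EuclideanSpace ℝ (Fin 3)) : ⟪v, perpC l u v⟫ = ‖perpC l u v‖ ^ 2 := by
  have hv : v = perpC l u v + (⟪u, v⟫ / l ^ 2) • u := by rw [perpC, sub_add_cancel]
  calc ⟪v, perpC l u v⟫ = ⟪perpC l u v + (⟪u, v⟫ / l ^ 2) • u, perpC l u v⟫ := by rw [← hv]
    _ = ‖perpC l u v‖ ^ 2 := by
      rw [inner_add_left, real_inner_smul_left, inner_perpC_self hl hu, mul_zero, add_zero,
        real_inner_self_eq_norm_sq]

/-- Derivative of the UDE Lyapunov function V_e along the estimation-error dynamics. -/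
theorem stmt10 (N : ℕ) (hN : 1 ≤ N) (cT lamT : ℝ) (hcT : 0 < cT) (hlamT : 0 < lamT)
    (c κ : Fin N → ℝ) (hc : ∀ j, 0 < c j) (hκ : ∀ j, 0 < κ j) (l : ℝ) (hl : 0 < l)
    (ℓ : Fin N → ℝ → EuclideanSpace ℝ (Fin 3)) (hℓ : ∀ j t, ‖ℓ j t‖ = l)
    (δT : ℝ → EuclideanSpace ℝ (Fin 3)) (δ : Fin N → ℝ → EuclideanSpace ℝ (Fin 3))
    (hδT : ∀ t, HasDerivAt δT (-lamT • (δT t + ∑ j, perpC l (ℓ j t) (δ j t))) t)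
    (hδ : ∀ j t, HasDerivAt (δ j)
      (-κ j • perpC l (ℓ j t) (perpC l (ℓ j t) (δ j t))) t) :
    ∀ t, HasDerivAt
      (fun s => (1 / 2) * cT * ‖δT s‖ ^ 2 +
        (1 / 2) * ∑ j, (cT * lamT * N / (2 * κ j) + c j / N) * ‖δ j s‖ ^ 2)
      (-(cT * lamT) * ‖δT t‖ ^ 2
        - cT * lamT * ∑ j, ⟪perpC l (ℓ j t) (δ j t), δT t⟫
        - ∑ j, (cT * lamT * N / 2 + c j * κ j / N) * ‖perpC l (ℓ j t) (δ j t)‖ ^ 2) t := by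
  intro t
  have hsum := HasDerivAt.fun_sum (u := Finset.univ) fun j _ =>
    (hδ j t).norm_sq.const_mul (cT * lamT * N / (2 * κ j) + c j / N)
  refine (((hδT t).norm_sq.const_mul ((1 / 2) * cT)).add (hsum.const_mul (1 / 2))).congr_deriv ?_
  have hterm : ∀ j, (cT * lamT * N / (2 * κ j) + c j / N) *
      (2 * ⟪δ j t, -κ j • perpC l (ℓ j t) (perpC l (ℓ j t) (δ j t))⟫) =
      -2 * ((cT * lamT * N / 2 + c j * κ j / N) * ‖perpC l (ℓ j t) (δ j t)‖ ^ 2) := by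
    intro j
    have hκj := (hκ j).ne'
    rw [perpC_perpC hl.ne' (hℓ j t), real_inner_smul_right, inner_perpC_right hl.ne' (hℓ j t)]
    field_simp
  have hcross : ⟪δT t, ∑ j, perpC l (ℓ j t) (δ j t)⟫ =
      ∑ j, ⟪perpC l (ℓ j t) (δ j t), δT t⟫ := by
    rw [real_inner_comm, sum_inner]
  simp only [hterm]
  rw [← Finset.mul_sum, real_inner_smul_right, inner_add_right, real_inner_self_eq_norm_sq, hcross]
  ring
end
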